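/- Let X be a finite nonempty set, r ∈ ℕ, n ∈ ℕ, f : X^r → ℝ≥0, m : X → ℝ≥0, and for each x₀ ∈ X let Φ_{x₀} be a Borel probability measure on the simplex Δ(X) = {M : X → ℝ≥0 : Σ_z M(z) = 1}. Define m̃ : X^{n+1} → ℝ by m̃(x₀, x₁, …, x_n) = m(x₀) · ∫_{Δ(X)} Π_{i=1}^n M(x_i) dΦ_{x₀}(M). Then Σ over (x⃗₁,…,x⃗_r) ∈ (X^{n+1})^r of (Π_{k=0}^n f(x₁ₖ, …, x_rₖ)) · Π_{i=1}^r m̃(x⃗_i) = Σ_{(x₁,…,x_r)∈X^r} f(x₁,…,x_r) · (Π_{i=1}^r m(x_i)) · ∫_{Δ(X)^r} (Σ_{(z₁,…,z_r)∈X^r} f(z₁,…,z_r) · Π_{i=1}^r M_i(z_i))^n d(Φ_{x₁} ⊗ ⋯ ⊗ Φ_{x_r})(M₁, …, M_r), where x⃗ᵢ = (x_{i,0}, …, x_{i,n}) and x_{iₖ} denotes its k-th replica component. -/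

import Mathlib

open MeasureTheory

/-- Over independent coordinates, the `n`-th moment of a multilinear polynomial
`∑ z, f z * ∏ i, g (M i) (z i)` expands into a sum, over `n`-tuples of multi-indices, of products of
one-coordinate moments. -/
theorem integral_sum_mul_prod_pow_eq {ι X E : Type*} [Fintype ι] [DecidableEq ι] [Fintype X]
    [MeasurableSpace E] (μ : ι → Measure E) [∀ i, SigmaFinite (μ i)] (n : ℕ)
    (f : (ι → X) → ℝ) (g : E → X → ℝ)
    (hg : ∀ (i : ι) (z : Fin n → X), Integrable (fun M => ∏ j, g M (z j)) (μ i)) :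
    ∫ Ms, (∑ z : ι → X, f z * ∏ i, g (Ms i) (z i)) ^ n ∂(Measure.pi μ)
      = ∑ zs : Fin n → ι → X, (∏ j, f (zs j)) * ∏ i, ∫ M, ∏ j, g M (zs j i) ∂(μ i) := by
  have expand (Ms : ι → E) : (∑ z : ι → X, f z * ∏ i, g (Ms i) (z i)) ^ n
      = ∑ zs : Fin n → ι → X, (∏ j, f (zs j)) * ∏ i, ∏ j, g (Ms i) (zs j i) := by
    rw [Fintype.sum_pow]
    refine Finset.sum_congr rfl fun zs _ => ?_
    rw [Finset.prod_mul_distrib, Finset.prod_comm]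
  simp_rw [expand]
  rw [integral_finsetSum]
  · refine Finset.sum_congr rfl fun zs _ => ?_
    rw [integral_const_mul,
      integral_fintype_prod_eq_prod (fun i M => ∏ j, g M (zs j i))]
  · intro zs _
    exact (Integrable.fintype_prod_dep (f := fun i M => ∏ j, g M (zs j i))
      fun i => hg i _).const_mul _

/-- Monomials in the coordinates are integrable on the standard simplex against any finite
measure. -/
theorem integrable_prod_stdSimplex {X κ : Type*} [Fintype X] [Fintype κ]
    (μ : Measure ↥(stdSimplex ℝ X)) [IsFiniteMeasure μ] (z : κ → X) :
    Integrable (fun M : ↥(stdSimplex ℝ X) => ∏ j, (M : X → ℝ) (z j)) μ := by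
  have hmeas : Measurable fun M : ↥(stdSimplex ℝ X) => ∏ j, (M : X → ℝ) (z j) :=
    Finset.measurable_prod _ fun j _ => (measurable_pi_apply (z j)).comp measurable_subtype_coe
  refine Integrable.of_bound hmeas.aestronglyMeasurable 1 (ae_of_all _ fun M => ?_)
  have nonneg (j : κ) : 0 ≤ (M : X → ℝ) (z j) := M.2.1 (z j)
  have le_one (j : κ) : (M : X → ℝ) (z j) ≤ 1 := (mem_Icc_of_mem_stdSimplex M.2 (z j)).2
  rw [Real.norm_of_nonneg (Finset.prod_nonneg fun j _ => nonneg j)]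
  exact Finset.prod_le_one (fun j _ => nonneg j) fun j _ => le_one j

/-- Under the replica symmetric ansatz, the factor-node partition function
`Z_f` of the replicated system with factor function `f` of degree `r` factorizes into the
replica symmetric expression `Z_f(n)`. -/
theorem replica_symmetric_factor_partition
    {X : Type*} [Fintype X] [Nonempty X] (r n : ℕ)
    (f : (Fin r → X) → ℝ) (hf : ∀ x, 0 ≤ f x)
    (m : X → ℝ) (hm : ∀ x, 0 ≤ m x)
    (Φ : X → Measure ↥(stdSimplex ℝ X)) [∀ x, IsProbabilityMeasure (Φ x)] :
    ∑ xss : Fin r → (Fin (n + 1) → X),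
        (∏ k : Fin (n + 1), f (fun i => xss i k)) *
          ∏ i : Fin r,
            (m (xss i 0) * ∫ M, ∏ j : Fin n, (M : X → ℝ) (xss i j.succ) ∂(Φ (xss i 0)))
    = ∑ x : Fin r → X,
        f x * (∏ i, m (x i)) *
          ∫ Ms, (∑ z : Fin r → X, f z * ∏ i : Fin r, ((Ms i : X → ℝ)) (z i)) ^ n
            ∂(Measure.pi fun i : Fin r => Φ (x i)) := by
  rw [← (Equiv.piComm fun (_ : Fin (n + 1)) (_ : Fin r) => X).sum_comp,
    ← (Fin.consEquiv fun _ : Fin (n + 1) => Fin r → X).sum_comp, Fintype.sum_prod_type]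
  refine Finset.sum_congr rfl fun x _ => ?_
  rw [integral_sum_mul_prod_pow_eq (fun i => Φ (x i)) n f (fun M => (M : X → ℝ))
    fun i z => integrable_prod_stdSimplex _ z, Finset.mul_sum]
  refine Finset.sum_congr rfl fun zs _ => ?_
  simp only [Equiv.piComm_apply, Function.swap, Fin.consEquiv_apply, Fin.prod_univ_succ (n := n),
    Fin.cons_zero, Fin.cons_succ, Finset.prod_mul_distrib]
  ring
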